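/- Let L_ω^n be an edge-weighted path on vertex set [n] (with edges {i, i+1} for i = 1, …, n−1 and arbitrary positive integer weights), and let I = I(L_ω^n) be its edge ideal. If I is integrally closed, then I is normal, i.e., I^k is integrally closed for every k ≥ 1. -/

import Mathlib

open MvPolynomial

/-- The edge ideal of an edge-weighted graph `G` with weight function `w`. -/
noncomputable def edgeIdeal (K : Type*) [Field K] {n : ℕ}
    (G : SimpleGraph (Fin n)) (w : Sym2 (Fin n) → ℕ) :
    Ideal (MvPolynomial (Fin n) K) :=
  Ideal.span {m | ∃ i j : Fin n, G.Adj i j ∧ m = X i ^ w s(i, j) * X j ^ w s(i, j)}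

/-- The integral closure of an ideal `I`. -/
def intClosure {R : Type*} [CommRing R] (I : Ideal R) : Set R :=
  {f | ∃ k : ℕ, 0 < k ∧ ∃ c : ℕ → R,
    (∀ i ∈ Finset.Icc 1 k, c i ∈ I ^ i) ∧
    f ^ k + ∑ i ∈ Finset.Icc 1 k, c i * f ^ (k - i) = 0}

/-- An ideal is integrally closed if it equals its integral closure. -/
def IsIntClosed {R : Type*} [CommRing R] (I : Ideal R) : Prop :=
  intClosure I = ↑I

theorem Finset.prod_range_split_reflect {M : Type*} [CommMonoid M] (f : ℕ → M) (j d m : ℕ) :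
    ∏ i ∈ Finset.range (j + 1 + d + (m + 1)), f i =
      (∏ i ∈ Finset.range (j + 1), f i) * (∏ i ∈ Finset.range d, f (j + 1 + i)) *
        ∏ i ∈ Finset.range (m + 1), f (j + 1 + d + m - i) := by
  rw [Finset.prod_range_add, Finset.prod_range_add,
    ← Finset.prod_range_reflect (fun i => f (j + 1 + d + i)) (m + 1)]
  congr 1
  refine Finset.prod_congr rfl fun i hi => ?_
  have := Finset.mem_range.1 hi
  congr 1
  omega

theorem Finset.sum_range_split_reflect (f : ℕ → ℕ) (j d m : ℕ) :
    ∑ i ∈ Finset.range (j + 1 + d + (m + 1)), f i =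
      (∑ i ∈ Finset.range (j + 1), f i) + (∑ i ∈ Finset.range d, f (j + 1 + i)) +
        ∑ i ∈ Finset.range (m + 1), f (j + 1 + d + m - i) :=
  Finset.prod_range_split_reflect (M := Multiplicative ℕ) f j d m

/-- Greedy matching along an unweighted path, with vertex covers certifying that both the size `M`
of the matching and the multiplicity `r` left over at the last vertex are optimal. -/
theorem exists_greedy_matching {R : Type*} [CommRing R] (I : Ideal R) (x : ℕ → R) (α : ℕ → ℕ)
    (j : ℕ) (h : ∀ i < j, x i * x (i + 1) ∈ I) :
    ∃ (M r : ℕ) (u : R) (A B : ℕ → ℕ), u ∈ I ^ M ∧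
      ∏ i ∈ Finset.range (j + 1), x i ^ α i = u * x j ^ r ∧
      (∀ i < j, 1 ≤ A i + A (i + 1)) ∧ (∀ i < j, 1 ≤ B i + B (i + 1)) ∧ 1 ≤ B j ∧
      ∑ i ∈ Finset.range (j + 1), A i * α i = M ∧
      ∑ i ∈ Finset.range (j + 1), B i * α i = M + r := by
  induction j with
  | zero => exact ⟨0, α 0, 1, 0, 1, by simp, by simp, by simp, by simp, by simp, by simp, by simp⟩
  | succ j ih =>
    obtain ⟨M, r, u, A, B, hu, hprod, hA, hB, hBj, hAs, hBs⟩ := ih fun i hi => h i (by omega)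
    have extend : ∀ (V : ℕ → ℕ) (s : ℕ), (∀ i < j, 1 ≤ V i + V (i + 1)) → 1 ≤ V j + s →
        (∀ i < j + 1, 1 ≤ Function.update V (j + 1) s i + Function.update V (j + 1) s (i + 1)) ∧
        ∑ i ∈ Finset.range (j + 1 + 1), Function.update V (j + 1) s i * α i =
          ∑ i ∈ Finset.range (j + 1), V i * α i + s * α (j + 1) := by
      intro V s hV hs
      constructor
      · intro i hi
        rw [Function.update_of_ne (by omega)]
        rcases Nat.lt_succ_iff_lt_or_eq.1 hi with hi | rfl
        · rw [Function.update_of_ne (by omega)]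
          exact hV i hi
        · simpa using hs
      · rw [Finset.sum_range_succ, Function.update_self]
        congr 1
        refine Finset.sum_congr rfl fun i hi => ?_
        have := Finset.mem_range.1 hi
        rw [Function.update_of_ne (by omega)]
    have hmem : ∀ s, u * (x j * x (j + 1)) ^ s ∈ I ^ (M + s) := fun s => by
      rw [pow_add]
      exact Ideal.mul_mem_mul hu (Ideal.pow_mem_pow (h j (by omega)) s)
    obtain ⟨hA1, hA2⟩ := extend A 1 hA (by omega)
    rcases le_total r (α (j + 1)) with hr | hr
    · obtain ⟨hB1, hB2⟩ := extend B 0 hB (by omega)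
      obtain ⟨t, ht⟩ := Nat.exists_eq_add_of_le hr
      refine ⟨M + r, t, _, _, _, hmem r, ?_, hB1, hA1, by simp, by rw [hB2, hBs]; simp,
        by rw [hA2, hAs, ht]; ring⟩
      rw [Finset.prod_range_succ, hprod, ht]
      ring
    · obtain ⟨t, ht⟩ := Nat.exists_eq_add_of_le hr
      refine ⟨M + α (j + 1), 0, _, _, _,
        Ideal.mul_mem_right (x j ^ t) _ (hmem (α (j + 1))), ?_, hA1, hA1, by simp,
        by rw [hA2, hAs]; ring, by rw [hA2, hAs]; ring⟩
      rw [Finset.prod_range_succ, hprod, ht]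
      ring

/-- Either the monomial with exponent `α` lies in `I ^ k`, or some weight vector on the vertices of
the path on `n` vertices with edge weights `w` separates it from `I ^ k`. -/
def PathDichotomy {R : Type*} [CommRing R] (I : Ideal R) (k n : ℕ) (x : ℕ → R) (w α : ℕ → ℕ) :
    Prop :=
  ∏ i ∈ Finset.range n, x i ^ α i ∈ I ^ k ∨
    ∃ (v : ℕ → ℕ) (c : ℕ), (∀ i, i + 1 < n → c ≤ w i * (v i + v (i + 1))) ∧
      ∑ i ∈ Finset.range n, v i * α i < k * c

section

variable {R : Type*} [CommRing R] {I : Ideal R} {k n : ℕ} {x : ℕ → R} {w α : ℕ → ℕ}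

theorem PathDichotomy.of_reflect
    (h : PathDichotomy I k n (fun i => x (n - 1 - i)) (fun i => w (n - 2 - i))
      (fun i => α (n - 1 - i))) : PathDichotomy I k n x w α := by
  rcases h with h | ⟨v, c, hv, hs⟩
  · left
    rwa [Finset.prod_range_reflect (fun i => x i ^ α i) n] at h
  · refine Or.inr ⟨fun i => v (n - 1 - i), c, fun i hi => ?_, ?_⟩
    · have := hv (n - 2 - i) (by omega)
      dsimp only at this ⊢
      rw [show n - 2 - (n - 2 - i) = i by omega, show n - 2 - i + 1 = n - 1 - i by omega] at this
      rw [show n - 1 - (i + 1) = n - 2 - i by omega, add_comm]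
      exact this
    · rw [← Finset.sum_range_reflect]
      refine lt_of_eq_of_lt (Finset.sum_congr rfl fun i hi => ?_) hs
      have := Finset.mem_range.1 hi
      dsimp only
      rw [show n - 1 - (n - 1 - i) = i by omega]

/-- A weight vector glued from one on the initial segment, one on the middle vertices, and one on
the final segment (enumerated from the far end). -/
def glueWeight (j d m : ℕ) (V U W : ℕ → ℕ) (i : ℕ) : ℕ :=
  if i ≤ j then V i else if i < j + 1 + d then U (i - (j + 1)) else W (j + 1 + d + m - i)

theorem sum_glueWeight (j d m : ℕ) (V U W α : ℕ → ℕ) :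
    ∑ i ∈ Finset.range (j + 1 + d + (m + 1)), glueWeight j d m V U W i * α i =
      ∑ i ∈ Finset.range (j + 1), V i * α i + ∑ i ∈ Finset.range d, U i * α (j + 1 + i) +
        ∑ i ∈ Finset.range (m + 1), W i * α (j + 1 + d + m - i) := by
  rw [Finset.sum_range_split_reflect]
  congr 1
  · congr 1
    all_goals
      refine Finset.sum_congr rfl fun i hi => ?_
      have := Finset.mem_range.1 hi
      unfold glueWeight
    · rw [if_pos (by omega)]
    · rw [if_neg (by omega), if_pos (by omega), Nat.add_sub_cancel_left]
  · refine Finset.sum_congr rfl fun i hi => ?_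
    have := Finset.mem_range.1 hi
    unfold glueWeight
    rw [if_neg (by omega), if_neg (by omega),
      show j + 1 + d + m - (j + 1 + d + m - i) = i by omega]

theorem glueWeight_left {j d m : ℕ} {V U W : ℕ → ℕ} {i : ℕ} (h : i ≤ j) :
    glueWeight j d m V U W i = V i := if_pos h

theorem glueWeight_mid {j d m : ℕ} {V U W : ℕ → ℕ} {i : ℕ} (h : i < d) :
    glueWeight j d m V U W (j + 1 + i) = U i := by
  unfold glueWeight
  rw [if_neg (by omega), if_pos (by omega), Nat.add_sub_cancel_left]

theorem glueWeight_right {j d m : ℕ} {V U W : ℕ → ℕ} {i : ℕ} (h : j + 1 + d ≤ i) :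
    glueWeight j d m V U W i = W (j + 1 + d + m - i) := by
  unfold glueWeight
  rw [if_neg (by omega), if_neg (by omega)]

theorem le_mul_glueWeight {c j d m : ℕ} {V U W : ℕ → ℕ}
    (hw : ∀ i, 1 ≤ w i) (hV : ∀ i < j, c ≤ V i + V (i + 1)) (hW : ∀ i < m, c ≤ W i + W (i + 1))
    (hmid : ∀ i ≤ d, c ≤ w (j + i) *
      (glueWeight j d m V U W (j + i) + glueWeight j d m V U W (j + i + 1))) (i : ℕ)
    (hi : i + 1 < j + 1 + d + (m + 1)) :
    c ≤ w i * (glueWeight j d m V U W i + glueWeight j d m V U W (i + 1)) := by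
  rcases lt_or_ge i j with h1 | h1
  · rw [glueWeight_left h1.le, glueWeight_left h1]
    exact (hV i h1).trans (Nat.le_mul_of_pos_left _ (hw i))
  obtain ⟨t, rfl⟩ := Nat.exists_eq_add_of_le h1
  rcases le_or_gt t d with h2 | h2
  · exact hmid t h2
  · rw [glueWeight_right (by omega), glueWeight_right (by omega)]
    have := hW (j + 1 + d + m - (j + t + 1)) (by omega)
    rw [show j + 1 + d + m - (j + t + 1) + 1 = j + 1 + d + m - (j + t) by omega, add_comm] at this
    exact this.trans (Nat.le_mul_of_pos_left _ (hw _))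

theorem le_mul_glueWeight_zero {c j m : ℕ} {V U W : ℕ → ℕ}
    (hw : ∀ i, 1 ≤ w i) (hV : ∀ i < j, c ≤ V i + V (i + 1)) (hW : ∀ i < m, c ≤ W i + W (i + 1))
    (hmid : c ≤ w j * (V j + W m)) (i : ℕ) (hi : i + 1 < j + 1 + 0 + (m + 1)) :
    c ≤ w i * (glueWeight j 0 m V U W i + glueWeight j 0 m V U W (i + 1)) := by
  refine le_mul_glueWeight hw hV hW (fun i hi => ?_) i hi
  obtain rfl : i = 0 := by omega
  rw [add_zero, glueWeight_left le_rfl, glueWeight_right (i := j + 1) le_rfl,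
    show j + 1 + 0 + m - (j + 1) = m by omega]
  exact hmid

theorem le_mul_glueWeight_two {c j m : ℕ} {V U W : ℕ → ℕ}
    (hw : ∀ i, 1 ≤ w i) (hV : ∀ i < j, c ≤ V i + V (i + 1)) (hW : ∀ i < m, c ≤ W i + W (i + 1))
    (hmid₀ : c ≤ w j * (V j + U 0)) (hmid₁ : c ≤ w (j + 1) * (U 0 + U 1))
    (hmid₂ : c ≤ w (j + 2) * (U 1 + W m)) (i : ℕ) (hi : i + 1 < j + 1 + 2 + (m + 1)) :
    c ≤ w i * (glueWeight j 2 m V U W i + glueWeight j 2 m V U W (i + 1)) := by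
  refine le_mul_glueWeight hw hV hW (fun i hi => ?_) i hi
  have e₀ : glueWeight j 2 m V U W (j + 1) = U 0 := glueWeight_mid (i := 0) (by omega)
  have e₁ : glueWeight j 2 m V U W (j + 2) = U 1 := glueWeight_mid (i := 1) (by omega)
  have e₂ : glueWeight j 2 m V U W (j + 3) = W m := by
    rw [glueWeight_right (i := j + 3) le_rfl, show j + 1 + 2 + m - (j + 3) = m by omega]
  interval_cases i
  · rw [add_zero, glueWeight_left le_rfl, e₀]
    exact hmid₀
  · rw [e₀, e₁]
    exact hmid₁
  · rw [e₁, e₂]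
    exact hmid₂

theorem add_le_combination {p q V V' U U' : ℕ} (hV : 1 ≤ V + V') (hU : 1 ≤ U + U') :
    p + q ≤ p * V + q * U + (p * V' + q * U') := by
  nlinarith

theorem sum_mul_combination (s : Finset ℕ) (A B β : ℕ → ℕ) (p q : ℕ) :
    ∑ i ∈ s, (p * A i + q * B i) * β i = p * ∑ i ∈ s, A i * β i + q * ∑ i ∈ s, B i * β i := by
  rw [Finset.mul_sum, Finset.mul_sum, ← Finset.sum_add_distrib]
  exact Finset.sum_congr rfl fun i _ => by ring

theorem pathDichotomy_of_one_heavy (hw : ∀ i, 1 ≤ w i)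
    (hI : ∀ i, i + 1 < n → (x i * x (i + 1)) ^ w i ∈ I) {j : ℕ} (hj : j + 1 < n)
    (hlight : ∀ i, i + 1 < n → i ≠ j → w i = 1) : PathDichotomy I k n x w α := by
  obtain ⟨m, rfl⟩ : ∃ m, n = j + 1 + 0 + (m + 1) := ⟨n - j - 2, by omega⟩
  have hlI : ∀ i, i + 1 < j + 1 + 0 + (m + 1) → i ≠ j → x i * x (i + 1) ∈ I := fun i h h' => by
    simpa [hlight i h h'] using hI i h
  obtain ⟨M, r, u, A, B, hu, hprod, hA, hB, hBj, hAs, hBs⟩ :=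
    exists_greedy_matching I x α j fun i hi => hlI i (by omega) (by omega)
  obtain ⟨M', r', u', A', B', hu', hprod', hA', hB', hBj', hAs', hBs'⟩ :=
    exists_greedy_matching I (fun i => x (j + 1 + 0 + m - i)) (fun i => α (j + 1 + 0 + m - i)) m
      fun i hi => by
        have := hlI (j + 1 + 0 + m - (i + 1)) (by omega) (by omega)
        rwa [show j + 1 + 0 + m - (i + 1) + 1 = j + 1 + 0 + m - i by omega, mul_comm] at this
  obtain ⟨a, ha⟩ : ∃ a, w j = a + 1 := ⟨w j - 1, by have := hw j; omega⟩
  by_cases hk : k ≤ M + M' + min r r' / (a + 1)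
  · left
    refine Ideal.pow_le_pow_right hk ?_
    set e := min r r' / (a + 1)
    have he : (a + 1) * e ≤ min r r' := Nat.mul_div_le _ _
    obtain ⟨s, hs⟩ := Nat.exists_eq_add_of_le (he.trans (min_le_left _ _))
    obtain ⟨s', hs'⟩ := Nat.exists_eq_add_of_le (he.trans (min_le_right _ _))
    have h1 : u * u' * ((x j * x (j + 1)) ^ w j) ^ e ∈ I ^ (M + M' + e) := by
      rw [pow_add, pow_add]
      exact Ideal.mul_mem_mul (Ideal.mul_mem_mul hu hu') (Ideal.pow_mem_pow (hI j hj) e)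
    convert Ideal.mul_mem_right (x j ^ s * x (j + 1) ^ s') _ h1 using 1
    rw [Finset.prod_range_split_reflect, hprod, hprod', hs, hs', ha,
      show j + 1 + 0 + m - m = j + 1 by omega]
    simp only [Finset.range_zero, Finset.prod_empty]
    ring
  · right
    have hk' := lt_of_not_ge hk
    obtain ⟨t, ht⟩ := Nat.exists_eq_add_of_le ((Nat.le_add_right _ _).trans hk'.le)
    rw [ht] at hk'
    have hlt' : min r r' < (a + 1) * t := by
      rw [mul_comm]
      exact (Nat.div_lt_iff_lt_mul (by omega)).1 (Nat.lt_of_add_lt_add_left hk')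
    rcases le_total r r' with hr | hr
    · rw [min_eq_left hr] at hlt'
      refine ⟨glueWeight j 0 m (fun i => a * A i + 1 * B i) 0 (fun i => (a + 1) * A' i + 0 * B' i),
        a + 1, le_mul_glueWeight_zero hw (fun i hi => ?_) (fun i hi => ?_) ?_, ?_⟩
      · exact add_le_combination (hA i hi) (hB i hi)
      · exact add_le_combination (p := a + 1) (q := 0) (hA' i hi) (hB' i hi)
      · rw [ha]
        exact Nat.le_mul_of_pos_right _ (by omega)
      · rw [sum_glueWeight, sum_mul_combination, sum_mul_combination, hAs, hBs, hAs', ht]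
        simp only [Finset.range_zero, Finset.sum_empty]
        linarith
    · rw [min_eq_right hr] at hlt'
      refine ⟨glueWeight j 0 m (fun i => (a + 1) * A i + 0 * B i) 0 (fun i => a * A' i + 1 * B' i),
        a + 1, le_mul_glueWeight_zero hw (fun i hi => ?_) (fun i hi => ?_) ?_, ?_⟩
      · exact add_le_combination (p := a + 1) (q := 0) (hA i hi) (hB i hi)
      · exact add_le_combination (hA' i hi) (hB' i hi)
      · rw [ha]
        exact Nat.le_mul_of_pos_right _ (by omega)
      · rw [sum_glueWeight, sum_mul_combination, sum_mul_combination, hAs, hAs', hBs', ht]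
        simp only [Finset.range_zero, Finset.sum_empty]
        linarith

theorem pathDichotomy_of_two_heavy_of_le (hw : ∀ i, 1 ≤ w i)
    (hI : ∀ i, i + 1 < n → (x i * x (i + 1)) ^ w i ∈ I) {j : ℕ} (hj : j + 3 < n)
    (hlight : ∀ i, i + 1 < n → i ≠ j → i ≠ j + 2 → w i = 1)
    (hj0 : 2 ≤ w j) (hj2 : 2 ≤ w (j + 2)) (hα : α (j + 1) ≤ α (j + 2)) :
    PathDichotomy I k n x w α := by
  obtain ⟨m, rfl⟩ : ∃ m, n = j + 1 + 2 + (m + 1) := ⟨n - j - 4, by omega⟩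
  have hlI : ∀ i, i + 1 < j + 1 + 2 + (m + 1) → i ≠ j → i ≠ j + 2 → x i * x (i + 1) ∈ I :=
    fun i h h' h'' => by simpa [hlight i h h' h''] using hI i h
  obtain ⟨M, r, u, A, B, hu, hprod, hA, hB, hBj, hAs, hBs⟩ :=
    exists_greedy_matching I x α j fun i hi => hlI i (by omega) (by omega) (by omega)
  obtain ⟨M', r', u', A', B', hu', hprod', hA', hB', hBj', hAs', hBs'⟩ :=
    exists_greedy_matching I (fun i => x (j + 1 + 2 + m - i)) (fun i => α (j + 1 + 2 + m - i)) m
      fun i hi => by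
        have := hlI (j + 1 + 2 + m - (i + 1)) (by omega) (by omega) (by omega)
        rwa [show j + 1 + 2 + m - (i + 1) + 1 = j + 1 + 2 + m - i by omega, mul_comm] at this
  obtain ⟨b, hb⟩ : ∃ b, w (j + 2) = b + 1 := ⟨w (j + 2) - 1, by omega⟩
  obtain ⟨q, hq⟩ := Nat.exists_eq_add_of_le hα
  set p := α (j + 1) with hp
  by_cases hk : k ≤ M + M' + p + min q r' / (b + 1)
  · left
    refine Ideal.pow_le_pow_right hk ?_
    set e := min q r' / (b + 1)
    have he : (b + 1) * e ≤ min q r' := Nat.mul_div_le _ _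
    obtain ⟨s, hs⟩ := Nat.exists_eq_add_of_le (he.trans (min_le_left _ _))
    obtain ⟨s', hs'⟩ := Nat.exists_eq_add_of_le (he.trans (min_le_right _ _))
    have h1 : u * u' * (x (j + 1) * x (j + 2)) ^ p * ((x (j + 2) * x (j + 3)) ^ w (j + 2)) ^ e ∈
        I ^ (M + M' + p + e) := by
      rw [pow_add, pow_add, pow_add]
      exact Ideal.mul_mem_mul (Ideal.mul_mem_mul (Ideal.mul_mem_mul hu hu')
        (Ideal.pow_mem_pow (hlI (j + 1) (by omega) (by omega) (by omega)) p))
        (Ideal.pow_mem_pow (hI (j + 2) hj) e)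
    convert Ideal.mul_mem_right (x j ^ r * x (j + 2) ^ s * x (j + 3) ^ s') _ h1 using 1
    rw [Finset.prod_range_split_reflect, hprod, hprod', hs', hb,
      show j + 1 + 2 + m - m = j + 3 by omega]
    simp only [Finset.prod_range_succ, Finset.range_zero, Finset.prod_empty, add_zero,
      show j + 1 + 1 = j + 2 from rfl, ← hp]
    rw [hq, hs]
    ring
  · right
    have hk' := lt_of_not_ge hk
    obtain ⟨t, ht⟩ := Nat.exists_eq_add_of_le ((Nat.le_add_right _ _).trans hk'.le)
    rw [ht] at hk'
    have hlt' : min q r' < (b + 1) * t := by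
      rw [mul_comm]
      exact (Nat.div_lt_iff_lt_mul (by omega)).1 (Nat.lt_of_add_lt_add_left hk')
    have hsum : ∀ U : ℕ → ℕ,
        ∑ i ∈ Finset.range 2, U i * α (j + 1 + i) = U 0 * p + U 1 * (p + q) := fun U => by
      rw [← hq, Finset.sum_range_succ, Finset.sum_range_one]
    rcases le_total q r' with hr | hr
    · rw [min_eq_left hr] at hlt'
      refine ⟨glueWeight j 2 m (fun i => (b + 1) * A i + 0 * B i) (fun i => if i = 0 then b else 1)
        (fun i => (b + 1) * A' i + 0 * B' i),
        b + 1, le_mul_glueWeight_two hw (fun i hi => ?_) (fun i hi => ?_) ?_ ?_ ?_, ?_⟩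
      · exact add_le_combination (p := b + 1) (q := 0) (hA i hi) (hB i hi)
      · exact add_le_combination (p := b + 1) (q := 0) (hA' i hi) (hB' i hi)
      · calc b + 1 ≤ 2 * b := by omega
          _ ≤ w j * b := Nat.mul_le_mul_right _ hj0
          _ ≤ _ := Nat.mul_le_mul_left _ (Nat.le_add_left _ _)
      · exact Nat.le_mul_of_pos_left _ (hw _)
      · rw [hb]
        exact Nat.le_mul_of_pos_right _ (by simp)
      · rw [sum_glueWeight, hsum, sum_mul_combination, sum_mul_combination, hAs, hAs', ht]
        simp only [if_true, one_ne_zero, if_false]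
        linarith
    · rw [min_eq_right hr] at hlt'
      refine ⟨glueWeight j 2 m (fun i => (b + 1) * A i + 0 * B i)
        (fun i => if i = 0 then b + 1 else 0) (fun i => b * A' i + 1 * B' i),
        b + 1, le_mul_glueWeight_two hw (fun i hi => ?_) (fun i hi => ?_) ?_ ?_ ?_, ?_⟩
      · exact add_le_combination (p := b + 1) (q := 0) (hA i hi) (hB i hi)
      · exact add_le_combination (hA' i hi) (hB' i hi)
      · exact (Nat.le_add_left _ _).trans (Nat.le_mul_of_pos_left _ (hw _))
      · exact (Nat.le_add_right _ _).trans (Nat.le_mul_of_pos_left _ (hw _))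
      · rw [hb]
        exact Nat.le_mul_of_pos_right _ (by omega)
      · rw [sum_glueWeight, hsum, sum_mul_combination, sum_mul_combination, hAs, hAs', hBs', ht]
        simp only [if_true, one_ne_zero, if_false]
        linarith

theorem pathDichotomy_of_two_heavy (hw : ∀ i, 1 ≤ w i)
    (hI : ∀ i, i + 1 < n → (x i * x (i + 1)) ^ w i ∈ I) {j : ℕ} (hj : j + 3 < n)
    (hlight : ∀ i, i + 1 < n → i ≠ j → i ≠ j + 2 → w i = 1)
    (hj0 : 2 ≤ w j) (hj2 : 2 ≤ w (j + 2)) : PathDichotomy I k n x w α := by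
  rcases le_total (α (j + 1)) (α (j + 2)) with h | h
  · exact pathDichotomy_of_two_heavy_of_le hw hI hj hlight hj0 hj2 h
  · refine .of_reflect (pathDichotomy_of_two_heavy_of_le (j := n - 4 - j) (fun i => hw _)
      (fun i hi => ?_) (by omega) (fun i hi h1 h2 => hlight _ (by omega) (by omega) (by omega))
      ?_ ?_ ?_)
    · have := hI (n - 2 - i) (by omega)
      rw [show n - 2 - i + 1 = n - 1 - i by omega, mul_comm] at this
      rwa [show n - 1 - (i + 1) = n - 2 - i by omega]
    · rwa [show n - 2 - (n - 4 - j) = j + 2 by omega]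
    · rwa [show n - 2 - (n - 4 - j + 2) = j by omega]
    · rwa [show n - 1 - (n - 4 - j + 1) = j + 2 by omega,
        show n - 1 - (n - 4 - j + 2) = j + 1 by omega]

theorem pathDichotomy_of_heavy_gap (hk : 1 ≤ k) (hw : ∀ i, 1 ≤ w i)
    (hI : ∀ i, i + 1 < n → (x i * x (i + 1)) ^ w i ∈ I)
    (hgap : ∀ i j, i < j → j + 1 < n → 2 ≤ w i → 2 ≤ w j → j = i + 2) :
    PathDichotomy I k n x w α := by
  rcases lt_or_ge n 2 with hn | hn
  · exact Or.inr ⟨0, 1, fun i hi => by omega, by simp; omega⟩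
  by_cases h : ∃ j, j + 1 < n ∧ 2 ≤ w j
  · classical
    obtain ⟨hj, hwj⟩ := Nat.find_spec h
    set j := Nat.find h
    have hmin : ∀ i, i + 1 < n → 2 ≤ w i → j ≤ i := fun i h1 h2 => Nat.find_min' h ⟨h1, h2⟩
    have hlight : ∀ i, i + 1 < n → i ≠ j → i ≠ j + 2 → w i = 1 := fun i hi h1 h2 => by
      by_contra h3
      have h4 : 2 ≤ w i := by have := hw i; omega
      have := hmin i hi h4
      exact h2 (hgap j i (by omega) hi hwj h4)
    by_cases h2 : j + 3 < n ∧ 2 ≤ w (j + 2)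
    · exact pathDichotomy_of_two_heavy hw hI h2.1 hlight hwj h2.2
    · refine pathDichotomy_of_one_heavy hw hI hj fun i hi h1 => ?_
      by_cases h3 : i = j + 2
      · subst h3
        have := hw (j + 2)
        omega
      · exact hlight i hi h1 h3
  · refine pathDichotomy_of_one_heavy (j := 0) hw hI (by omega) fun i hi _ => ?_
    by_contra h3
    exact h ⟨i, hi, by have := hw i; omega⟩

end

theorem subset_intClosure {R : Type*} [CommRing R] (J : Ideal R) : (J : Set R) ⊆ intClosure J :=
  fun f hf => ⟨1, one_pos, fun _ => -f, by simpa using hf, by simp⟩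

theorem mem_intClosure_of_pow_mem {R : Type*} [CommRing R] {J : Ideal R} {f : R} {m : ℕ}
    (hm : 0 < m) (hf : f ^ m ∈ J ^ m) : f ∈ intClosure J := by
  refine ⟨m, hm, fun i => if i = m then -f ^ m else 0, fun i _ => ?_, ?_⟩
  · dsimp only
    split_ifs with h
    · subst h
      exact neg_mem hf
    · exact zero_mem _
  · rw [Finset.sum_eq_single_of_mem m (by simp; omega) fun i _ hi => by simp [hi]]
    simp

/-- The valuation of a prime element bounds integral closures from below. -/
theorem pow_dvd_map_of_mem_intClosure {R S : Type*} [CommRing R] [CommRing S] [IsDomain S]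
    (φ : R →+* S) {J : Ideal R} {T : S} (hT : Prime T) {d : ℕ} (hJ : ∀ g ∈ J, T ^ d ∣ φ g)
    {f : R} (hf : f ∈ intClosure J) : T ^ d ∣ φ f := by
  classical
  by_contra hd
  have hex : ∃ m, ¬ T ^ m ∣ φ f := ⟨d, hd⟩
  obtain ⟨m, hm⟩ : ∃ m, Nat.find hex = m + 1 := Nat.exists_eq_succ_of_ne_zero fun h => by
    simpa [h] using Nat.find_spec hex
  have hmd : m < d := by
    have := Nat.find_min' hex hd
    omega
  obtain ⟨h, hh⟩ : T ^ m ∣ φ f := by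
    by_contra h
    have := Nat.find_min' hex h
    omega
  have hTh : ¬ T ∣ h := fun ⟨s, hs⟩ => by
    refine Nat.find_spec hex ⟨s, ?_⟩
    rw [hm, hh, hs]
    ring
  obtain ⟨N, hN, c, hc, hsum⟩ := hf
  have hJi : ∀ i, ∀ g ∈ J ^ i, (T ^ d) ^ i ∣ φ g := fun i g hg => by
    have hle : J ≤ (Ideal.span {T ^ d}).comap φ := fun g hg =>
      Ideal.mem_span_singleton.2 (hJ g hg)
    have := Ideal.le_comap_pow φ i (Ideal.pow_right_mono hle i hg)
    rwa [Ideal.mem_comap, Ideal.span_singleton_pow, Ideal.mem_span_singleton] at this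
  have key : T ^ (m * N + 1) ∣ φ f ^ N := by
    have h0 := congrArg φ hsum
    rw [map_add, map_pow, map_zero, map_sum] at h0
    rw [eq_neg_of_add_eq_zero_left h0, dvd_neg]
    refine Finset.dvd_sum fun i hi => ?_
    have hi' := Finset.mem_Icc.1 hi
    rw [map_mul, map_pow]
    have h1 := mul_dvd_mul (hJi i _ (hc i hi)) (pow_dvd_pow_of_dvd (Dvd.intro h hh.symm) (N - i))
    refine (pow_dvd_pow T ?_).trans (by rwa [← pow_mul, ← pow_mul, ← pow_add] at h1)
    obtain ⟨s, hs⟩ := Nat.exists_eq_add_of_le hi'.2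
    rw [hs, Nat.add_sub_cancel_left]
    nlinarith
  rw [hh, mul_pow, ← pow_mul, pow_succ] at key
  exact hTh (hT.dvd_of_dvd_pow
    ((mul_dvd_mul_iff_left (pow_ne_zero _ hT.ne_zero)).1 key))

section Grading

variable {σ K : Type*} [Fintype σ] [Field K]

/-- The homomorphism recording the `v`-weight of each monomial as a power of a new variable. -/
noncomputable def weightHom (K : Type*) [Field K] (v : σ → ℕ) :
    MvPolynomial σ K →ₐ[K] Polynomial (MvPolynomial σ K) :=
  aeval fun i => Polynomial.C (X i) * Polynomial.X ^ v i

theorem weightHom_monomial (v : σ → ℕ) (β : σ →₀ ℕ) (a : K) :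
    weightHom K v (monomial β a) =
      Polynomial.C (monomial β a) * Polynomial.X ^ ∑ i, v i * β i := by
  rw [weightHom, aeval_monomial, monomial_eq, Finsupp.prod_fintype _ _ (by simp),
    Finsupp.prod_fintype _ _ (by simp)]
  simp only [mul_pow, Finset.prod_mul_distrib, ← pow_mul, Finset.prod_pow_eq_pow_sum, map_mul,
    map_prod, map_pow, mul_assoc]
  rfl

theorem coeff_coeff_weightHom (v : σ → ℕ) (f : MvPolynomial σ K) (β : σ →₀ ℕ) :
    coeff β ((weightHom K v f).coeff (∑ i, v i * β i)) = coeff β f := by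
  classical
  induction f using MvPolynomial.induction_on' with
  | monomial γ a =>
    rw [weightHom_monomial, Polynomial.coeff_C_mul_X_pow]
    split_ifs with h
    · rfl
    · rw [coeff_zero, coeff_monomial, if_neg fun hγ => h (by rw [hγ])]
  | add f g hf hg => rw [map_add, Polynomial.coeff_add, coeff_add, coeff_add, hf, hg]

theorem le_weight_of_pow_dvd_weightHom {v : σ → ℕ} {f : MvPolynomial σ K} {d : ℕ}
    (h : Polynomial.X ^ d ∣ weightHom K v f) {β : σ →₀ ℕ} (hβ : β ∈ f.support) :
    d ≤ ∑ i, v i * β i := by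
  by_contra hlt
  have h0 := Polynomial.X_pow_dvd_iff.1 h _ (lt_of_not_ge hlt)
  have := coeff_coeff_weightHom v f β
  rw [h0, coeff_zero] at this
  exact mem_support_iff.1 hβ this.symm

end Grading

theorem edgeIdeal_eq_span_monomial (K : Type*) [Field K] {n : ℕ}
    (G : SimpleGraph (Fin n)) (w : Sym2 (Fin n) → ℕ) :
    edgeIdeal K G w = Ideal.span ((fun s => monomial s (1 : K)) '' {s | ∃ i j : Fin n, G.Adj i j ∧
      s = Finsupp.single i (w s(i, j)) + Finsupp.single j (w s(i, j))}) := by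
  unfold edgeIdeal
  congr 1
  ext m
  constructor
  · rintro ⟨i, j, h, rfl⟩
    exact ⟨_, ⟨i, j, h, rfl⟩, by simp [X_pow_eq_monomial, monomial_mul]⟩
  · rintro ⟨_, ⟨i, j, h, rfl⟩, rfl⟩
    exact ⟨i, j, h, by simp [X_pow_eq_monomial, monomial_mul]⟩

/-- In a weighted path with integrally closed edge ideal, two edges of weight at least two are
separated by exactly one edge. -/
theorem eq_add_two_of_isIntClosed_edgeIdeal (K : Type*) [Field K] {n : ℕ}
    (G : SimpleGraph (Fin n)) (w : Sym2 (Fin n) → ℕ)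
    (hG : ∀ i j : Fin n, G.Adj i j ↔ (i.val + 1 = j.val ∨ j.val + 1 = i.val))
    (hw : ∀ e ∈ G.edgeSet, 1 ≤ w e) (hic : IsIntClosed (edgeIdeal K G w))
    {i i' j j' : Fin n} (hi : i.val + 1 = i'.val) (hj : j.val + 1 = j'.val) (hij : i < j)
    (hwi : 2 ≤ w s(i, i')) (hwj : 2 ≤ w s(j, j')) : j.val = i.val + 2 := by
  by_contra hne
  obtain ⟨a, ha⟩ : ∃ a, w s(i, i') = a + 1 := ⟨w s(i, i') - 1, by omega⟩
  obtain ⟨b, hb⟩ : ∃ b, w s(j, j') = b + 1 := ⟨w s(j, j') - 1, by omega⟩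
  have hmem : ∀ {s t : Fin n}, s.val + 1 = t.val →
      (X s * X t : MvPolynomial (Fin n) K) ^ w s(s, t) ∈ edgeIdeal K G w := fun {s t} h =>
    Ideal.subset_span ⟨s, t, (hG s t).2 (Or.inl h), mul_pow _ _ _⟩
  have hf : ((X i * X i') ^ a * (X j * X j') ^ b : MvPolynomial (Fin n) K) ∈ edgeIdeal K G w := by
    rw [← SetLike.mem_coe, ← hic]
    refine mem_intClosure_of_pow_mem (m := (a + 1) * (b + 1)) (by positivity) ?_
    have hle : (a + 1) * (b + 1) ≤ a * (b + 1) + b * (a + 1) := by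
      nlinarith [mul_le_mul (show 1 ≤ a by omega) (show 1 ≤ b by omega) zero_le_one (Nat.zero_le a)]
    refine Ideal.pow_le_pow_right hle ?_
    have h1 := Ideal.mul_mem_mul (Ideal.pow_mem_pow (hmem hi) (a * (b + 1)))
      (Ideal.pow_mem_pow (hmem hj) (b * (a + 1)))
    rw [← pow_add, ha, hb] at h1
    convert h1 using 1
    ring
  have hf' : ((X i * X i') ^ a * (X j * X j') ^ b : MvPolynomial (Fin n) K) =
      monomial (Finsupp.single i a + Finsupp.single i' a +
        (Finsupp.single j b + Finsupp.single j' b)) 1 := by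
    simp [mul_pow, X_pow_eq_monomial, monomial_mul]
  rw [hf', edgeIdeal_eq_span_monomial, mem_ideal_span_monomial_image] at hf
  obtain ⟨_, ⟨p, q, hpq, rfl⟩, hle⟩ := hf _ (mem_support_iff.2 (by
    rw [coeff_monomial, if_pos rfl]
    exact one_ne_zero))
  have hpos := hw s(p, q) hpq
  wlog hpq' : p.val + 1 = q.val generalizing p q
  · refine this q p hpq.symm (by rwa [Sym2.eq_swap, add_comm]) (by rwa [Sym2.eq_swap]) ?_
    rcases (hG p q).1 hpq with h | h
    · exact absurd h hpq'
    · exact h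
  have hp := hle p
  have hq := hle q
  have hpne : q ≠ p := fun h => by simp [h] at hpq'
  simp only [Finsupp.add_apply, Finsupp.single_apply, if_true, hpne, hpne.symm, if_false,
    Fin.ext_iff] at hp hq
  by_cases hpi : p = i
  · obtain rfl := hpi
    obtain rfl : q = i' := Fin.ext (by omega)
    rw [ha] at hp hq
    split_ifs at hp hq <;> omega
  by_cases hpj : p = j
  · obtain rfl := hpj
    obtain rfl : q = j' := Fin.ext (by omega)
    rw [hb] at hp hq
    split_ifs at hp hq <;> omega
  rw [Fin.ext_iff] at hpi hpj
  split_ifs at hp hq <;> omega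

/-- Let `L_ω^n` be an edge-weighted path on `[n]` (edges `{i, i+1}`, `i = 1,…,n-1`)
with arbitrary positive integer weights. If its edge ideal is integrally closed, then
it is normal: every power `I^k`, `k ≥ 1`, is integrally closed. -/
theorem edgeIdeal_path_normal_of_intClosed
    (K : Type*) [Field K] {n : ℕ}
    (G : SimpleGraph (Fin n)) (w : Sym2 (Fin n) → ℕ)
    (hG : ∀ i j : Fin n, G.Adj i j ↔ (i.val + 1 = j.val ∨ j.val + 1 = i.val))
    (hw : ∀ e ∈ G.edgeSet, 1 ≤ w e)
    (hic : IsIntClosed (edgeIdeal K G w)) :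
    ∀ k : ℕ, 1 ≤ k → IsIntClosed (edgeIdeal K G w ^ k) := by
  intro k hk
  refine Set.Subset.antisymm (fun f hf => ?_) (subset_intClosure _)
  rw [SetLike.mem_coe, f.as_sum]
  refine sum_mem fun β hβ => ?_
  let x : ℕ → MvPolynomial (Fin n) K := fun i => if h : i < n then X ⟨i, h⟩ else 1
  let w' : ℕ → ℕ := fun i =>
    if h : i + 1 < n then w s(⟨i, Nat.lt_of_succ_lt h⟩, ⟨i + 1, h⟩) else 1
  let α : ℕ → ℕ := fun i => if h : i < n then β ⟨i, h⟩ else 0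
  have hadj : ∀ i (h : i + 1 < n), G.Adj ⟨i, Nat.lt_of_succ_lt h⟩ ⟨i + 1, h⟩ := fun i h =>
    (hG _ _).2 (Or.inl rfl)
  have hw' : ∀ i, 1 ≤ w' i := fun i => by
    dsimp only [w']
    split_ifs with h
    · exact hw _ (hadj i h)
    · exact le_rfl
  have hI : ∀ i, i + 1 < n → (x i * x (i + 1)) ^ w' i ∈ edgeIdeal K G w := fun i h => by
    simp only [x, w', h, Nat.lt_of_succ_lt h, dif_pos]
    exact Ideal.subset_span ⟨_, _, hadj i h, mul_pow _ _ _⟩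
  have hgap : ∀ i j, i < j → j + 1 < n → 2 ≤ w' i → 2 ≤ w' j → j = i + 2 := by
    intro i j hij hj h1 h2
    have hi : i + 1 < n := by omega
    simp only [w', hi, hj, dif_pos] at h1 h2
    exact eq_add_two_of_isIntClosed_edgeIdeal K G w hG hw hic rfl rfl hij h1 h2
  rcases pathDichotomy_of_heavy_gap (α := α) hk hw' hI hgap with h | ⟨v, c, hv, hlt⟩
  · have hprod : ∏ i ∈ Finset.range n, x i ^ α i = monomial β 1 := by
      rw [Finset.prod_range, monomial_eq, Finsupp.prod_fintype _ _ (by simp)]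
      simp [x, α]
    rw [hprod] at h
    rw [← mul_one (coeff β f), ← C_mul_monomial]
    exact Ideal.mul_mem_left _ _ h
  · exfalso
    have hedge : ∀ {p q : Fin n}, p.val + 1 = q.val → c ≤ w s(p, q) * (v p + v q) := by
      rintro ⟨p, hp⟩ ⟨_, hq⟩ rfl
      simpa [w', hq] using hv p hq
    have hgen : edgeIdeal K G w ≤
        (Ideal.span {Polynomial.X ^ c}).comap (weightHom K fun i : Fin n => v i) := by
      refine Ideal.span_le.2 ?_
      rintro _ ⟨p, q, hpq, rfl⟩
      have hc : c ≤ w s(p, q) * (v p + v q) := by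
        rcases (hG p q).1 hpq with h | h
        · exact hedge h
        · rw [Sym2.eq_swap, add_comm]
          exact hedge h
      rw [SetLike.mem_coe, Ideal.mem_comap, Ideal.mem_span_singleton]
      refine (pow_dvd_pow _ hc).trans ⟨Polynomial.C (X p * X q) ^ w s(p, q), ?_⟩
      simp only [weightHom, map_mul, map_pow, aeval_X]
      ring
    have hpow : ∀ g ∈ edgeIdeal K G w ^ k,
        Polynomial.X ^ (c * k) ∣ weightHom K (fun i : Fin n => v i) g := fun g hg => by
      have := Ideal.le_comap_pow _ k (Ideal.pow_right_mono hgen k hg)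
      rwa [Ideal.mem_comap, Ideal.span_singleton_pow, Ideal.mem_span_singleton, ← pow_mul] at this
    have hle := le_weight_of_pow_dvd_weightHom (pow_dvd_map_of_mem_intClosure
      (weightHom K fun i : Fin n => v i).toRingHom Polynomial.prime_X hpow hf) hβ
    rw [Finset.sum_range] at hlt
    simp only [α, Fin.is_lt, dif_pos, Fin.eta] at hlt
    rw [mul_comm] at hle
    omega
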